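/- arXiv:0705.0705 — 2 statements merged into one kernel-verified Lean document; each statement's English description precedes it below -/
import Mathlib

section
/- Generalized Berezin–Cramér identity: for an n×n matrix A, ordered index sets I = {i₁<⋯<i_p} and J = {j₁<⋯<j_p}, one has ∫ dψ̄ dψ (ψ_{j₁}ψ̄_{i₁}⋯ψ_{j_p}ψ̄_{i_p}) e^{−ψ̄Aψ} = (−1)^{ΣI+ΣJ} det(A^{I,J}), where A^{I,J} is A with rows in I and columns in J deleted and ΣI = i₁+⋯+i_p. -/
open Finset

/-- The Grassmann (exterior) algebra on `2n` anticommuting generators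
`ψ₁, ψ̄₁, …, ψₙ, ψ̄ₙ`, modeled by coefficient functions indexed by subsets of the
generators.  Generator `2i` is `ψᵢ` and generator `2i+1` is `ψ̄ᵢ`, so that the top
monomial (in increasing generator order) is `ψ₁ψ̄₁ψ₂ψ̄₂⋯ψₙψ̄ₙ`, matching the Berezin
convention `∫ dψ̄ dψ ψᵢψ̄ᵢ = 1`, i.e. the sign convention for which
`∫ dψ̄ dψ e^{−ψ̄Aψ} = det A`. -/
abbrev Grassmann (n : ℕ) (R : Type*) := Finset (Fin (2 * n)) → R

/-- Koszul sign produced when multiplying the monomials indexed by `T` and `U`. -/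
def gsign {n : ℕ} (T U : Finset (Fin (2 * n))) : ℤ :=
  (-1) ^ ((T ×ˢ U).filter fun q => q.2 < q.1).card

/-- Product in the Grassmann algebra. -/
def gmul {n : ℕ} {R : Type*} [CommRing R] (f g : Grassmann n R) : Grassmann n R :=
  fun S => ∑ T ∈ S.powerset, ((gsign T (S \ T) : ℤ) : R) * f T * g (S \ T)

/-- Unit of the Grassmann algebra. -/
def gone {n : ℕ} {R : Type*} [CommRing R] : Grassmann n R :=
  fun S => if S = ∅ then 1 else 0

/-- Powers in the Grassmann algebra. -/
def gpow {n : ℕ} {R : Type*} [CommRing R] (f : Grassmann n R) : ℕ → Grassmann n R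
  | 0 => gone
  | k + 1 => gmul f (gpow f k)

/-- Exponential in the Grassmann algebra (a finite sum, since every element with no
constant term is nilpotent: monomials of degree `> 2n` vanish). -/
noncomputable def gexp {n : ℕ} {R : Type*} [CommRing R] [Algebra ℚ R]
    (f : Grassmann n R) : Grassmann n R :=
  fun S => ∑ k ∈ Finset.range (2 * n + 1),
    algebraMap ℚ R ((Nat.factorial k : ℚ))⁻¹ * gpow f k S

/-- The generator `ψᵢ`. -/
def psi {n : ℕ} {R : Type*} [CommRing R] (i : Fin n) : Grassmann n R :=
  fun S => if S = {(⟨2 * i.1, by have := i.2; omega⟩ : Fin (2 * n))} then 1 else 0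

/-- The generator `ψ̄ᵢ`. -/
def psibar {n : ℕ} {R : Type*} [CommRing R] (i : Fin n) : Grassmann n R :=
  fun S => if S = {(⟨2 * i.1 + 1, by have := i.2; omega⟩ : Fin (2 * n))} then 1 else 0

/-- The quadratic element `ψ̄Aψ = ∑_{i,j} A_{ij} ψ̄ᵢψⱼ`. -/
def quadForm {n : ℕ} {R : Type*} [CommRing R] (A : Matrix (Fin n) (Fin n) R) :
    Grassmann n R :=
  fun S => ∑ i, ∑ j, A i j * gmul (psibar i) (psi j) S

/-- Berezin integration `∫ dψ̄ dψ`: extraction of the coefficient of the top monomial. -/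
def berezin {n : ℕ} {R : Type*} [CommRing R] (f : Grassmann n R) : R :=
  f Finset.univ


/-- Product of a list of Grassmann elements (in the given order). -/
def gprodList {n : ℕ} {R : Type*} [CommRing R] : List (Grassmann n R) → Grassmann n R
  | [] => gone
  | f :: fs => gmul f (gprodList fs)

theorem sign_of_strictMono_halves {p m : ℕ} (σ : Equiv.Perm (Fin (p + m)))
    (h₁ : StrictMono fun k => σ (Fin.castAdd m k))
    (h₂ : StrictMono fun k => σ (Fin.natAdd p k)) :
    Equiv.Perm.sign σ = (-1) ^ ((∑ k : Fin p, (σ (Fin.castAdd m k) : ℕ)) + ∑ k : Fin p, (k : ℕ)) := by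
  have count (k : Fin p) :
      (k : ℕ) + #{b : Fin m | σ (Fin.natAdd p b) < σ (Fin.castAdd m k)} =
        (σ (Fin.castAdd m k) : ℕ) := by
    have h : #{x : Fin (p + m) | σ x < σ (Fin.castAdd m k)} = (σ (Fin.castAdd m k) : ℕ) := by
      rw [← Fin.card_Iio, ← card_map σ.toEmbedding]
      congr 1
      ext x
      simp
    have h' : #{l : Fin p | σ (Fin.castAdd m l) < σ (Fin.castAdd m k)} = (k : ℕ) := by
      have (l : Fin p) : σ (Fin.castAdd m l) < σ (Fin.castAdd m k) ↔ l < k := h₁.lt_iff_lt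
      simp [this, filter_gt_eq_Iio]
    rw [← h, card_filter (p := fun x => σ x < _), Fin.sum_univ_add, ← card_filter, ← card_filter,
      h']
  rw [Equiv.Perm.sign_eq_prod_prod_Iio]
  have key (j : Fin (p + m)) : (∏ i ∈ Iio j, if σ i < σ j then (1 : ℤˣ) else -1) =
      ∏ i, if i < j then (if σ i < σ j then 1 else -1) else 1 := by
    rw [← prod_filter, filter_gt_eq_Iio]
  simp only [key, Fin.prod_univ_add]
  have e₁ (i j : Fin p) : (if Fin.castAdd m i < Fin.castAdd m j then
      (if σ (Fin.castAdd m i) < σ (Fin.castAdd m j) then (1 : ℤˣ) else -1) else 1) = 1 := by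
    have : σ (Fin.castAdd m i) < σ (Fin.castAdd m j) ↔ i < j := h₁.lt_iff_lt
    simp only [this, (Fin.strictMono_castAdd m).lt_iff_lt]
    split_ifs <;> rfl
  have e₂ (i j : Fin m) : (if Fin.natAdd p i < Fin.natAdd p j then
      (if σ (Fin.natAdd p i) < σ (Fin.natAdd p j) then (1 : ℤˣ) else -1) else 1) = 1 := by
    have : σ (Fin.natAdd p i) < σ (Fin.natAdd p j) ↔ i < j := h₂.lt_iff_lt
    simp only [this, Fin.natAdd_lt_natAdd_iff]
    split_ifs <;> rfl
  have e₃ (i : Fin m) (j : Fin p) : ¬ Fin.natAdd p i < Fin.castAdd m j := by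
    simp only [Fin.lt_def, Fin.val_natAdd, Fin.val_castAdd]; omega
  have e₄ (i : Fin p) (j : Fin m) : Fin.castAdd m i < Fin.natAdd p j := by
    simp only [Fin.lt_def, Fin.val_natAdd, Fin.val_castAdd]; omega
  have e₅ (i : Fin p) (j : Fin m) :
      (if σ (Fin.castAdd m i) < σ (Fin.natAdd p j) then (1 : ℤˣ) else -1) =
      if σ (Fin.natAdd p j) < σ (Fin.castAdd m i) then -1 else 1 := by
    have : σ (Fin.castAdd m i) ≠ σ (Fin.natAdd p j) := σ.injective.ne (e₄ i j).ne
    rcases lt_or_gt_of_ne this with h | h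
    · simp [h, h.not_gt]
    · simp [h, h.not_gt]
  simp only [e₁, e₂, e₃, e₄, e₅, if_true, if_false, prod_const_one, one_mul, mul_one]
  rw [prod_comm]
  simp only [← prod_filter, prod_const]
  rw [prod_pow_eq_pow_sum, ← sum_add_distrib]
  have : ∑ k : Fin p, ((σ (Fin.castAdd m k) : ℕ) + k) =
      ∑ k : Fin p, #{b : Fin m | σ (Fin.natAdd p b) < σ (Fin.castAdd m k)} +
      2 * ∑ k : Fin p, (k : ℕ) := by
    rw [mul_sum, ← sum_add_distrib]
    refine sum_congr rfl fun k _ => ?_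
    have := count k
    omega
  rw [this, pow_add, pow_mul]
  simp

/-- The permutation listing the values of `I` first and the complement of its range afterwards. -/
noncomputable def shuffle {p m : ℕ} (I : Fin p → Fin (p + m)) (hI : StrictMono I)
    (hIc : ((univ.image I)ᶜ : Finset (Fin (p + m))).card = m) : Equiv.Perm (Fin (p + m)) :=
  Equiv.ofBijective (Fin.addCases I fun a => (univ.image I)ᶜ.orderEmbOfFin hIc a) <| by
    refine Finite.injective_iff_bijective.1 fun a b => ?_
    have mem (c : Fin m) (k : Fin p) : I k ≠ (univ.image I)ᶜ.orderEmbOfFin hIc c := by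
      have := orderEmbOfFin_mem _ hIc c
      simp only [mem_compl, mem_image, mem_univ, true_and, not_exists] at this
      exact this k
    refine Fin.addCases (fun k => ?_) (fun k => ?_) a <;>
      refine Fin.addCases (fun l => ?_) (fun l => ?_) b
    · simp [hI.injective.eq_iff]
    · simp [mem l k]
    · simp [(mem k l).symm]
    · simp

@[simp]
theorem shuffle_castAdd {p m : ℕ} (I : Fin p → Fin (p + m)) (hI : StrictMono I)
    (hIc : ((univ.image I)ᶜ : Finset (Fin (p + m))).card = m) (k : Fin p) :
    shuffle I hI hIc (Fin.castAdd m k) = I k := by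
  simp [shuffle]

@[simp]
theorem shuffle_natAdd {p m : ℕ} (I : Fin p → Fin (p + m)) (hI : StrictMono I)
    (hIc : ((univ.image I)ᶜ : Finset (Fin (p + m))).card = m) (k : Fin m) :
    shuffle I hI hIc (Fin.natAdd p k) = (univ.image I)ᶜ.orderEmbOfFin hIc k := by
  simp [shuffle]

theorem sign_shuffle {p m : ℕ} (I : Fin p → Fin (p + m)) (hI : StrictMono I)
    (hIc : ((univ.image I)ᶜ : Finset (Fin (p + m))).card = m) :
    Equiv.Perm.sign (shuffle I hI hIc) = (-1) ^ ((∑ k, (I k : ℕ)) + ∑ k : Fin p, (k : ℕ)) := by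
  rw [sign_of_strictMono_halves]
  · simp
  · simpa using hI
  · simp only [shuffle_natAdd]
    exact OrderEmbedding.strictMono _

/-- Replacing the rows `I k` by the basis vectors `e (J k)` computes a signed complementary
minor. -/
theorem det_of_rows_eq_single {R : Type*} [CommRing R] {n p m : ℕ} (hn : n = p + m)
    (A B : Matrix (Fin n) (Fin n) R) (I J : Fin p → Fin n) (hI : StrictMono I) (hJ : StrictMono J)
    (hIc : ((univ.image I)ᶜ : Finset (Fin n)).card = m)
    (hJc : ((univ.image J)ᶜ : Finset (Fin n)).card = m)
    (hB : ∀ k, B (I k) = Pi.single (J k) 1) (hA : ∀ i ∉ univ.image I, B i = A i) :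
    B.det = (-1 : R) ^ ((∑ k, ((I k : ℕ) + 1)) + ∑ k, ((J k : ℕ) + 1)) *
      (A.submatrix (fun a : Fin m => (univ.image I)ᶜ.orderEmbOfFin hIc a)
        (fun a : Fin m => (univ.image J)ᶜ.orderEmbOfFin hJc a)).det := by
  subst hn
  set M := A.submatrix (fun a : Fin m => (univ.image I)ᶜ.orderEmbOfFin hIc a)
        (fun a : Fin m => (univ.image J)ᶜ.orderEmbOfFin hJc a) with hM
  have hC : ((B.submatrix (shuffle I hI hIc) (shuffle J hJ hJc)).submatrix
      finSumFinEquiv finSumFinEquiv).det = M.det := by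
    have : (B.submatrix (shuffle I hI hIc) (shuffle J hJ hJc)).submatrix
        finSumFinEquiv finSumFinEquiv = Matrix.fromBlocks 1 0
          (A.submatrix (fun a : Fin m => (univ.image I)ᶜ.orderEmbOfFin hIc a) J) M := by
      have hmem (c : Fin m) : (univ.image I)ᶜ.orderEmbOfFin hIc c ∉ univ.image I :=
        mem_compl.1 (orderEmbOfFin_mem _ hIc c)
      ext (k | a) (l | b)
      · rw [Matrix.fromBlocks_apply₁₁]
        simp [hB, Pi.single_apply, Matrix.one_apply, hJ.injective.eq_iff, eq_comm]
      · have := orderEmbOfFin_mem _ hJc b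
        simp only [mem_compl, mem_image, mem_univ, true_and, not_exists] at this
        rw [Matrix.fromBlocks_apply₁₂]
        simp [hB, Ne.symm (this k)]
      · rw [Matrix.fromBlocks_apply₂₁]
        simp [hA _ (hmem a)]
      · rw [Matrix.fromBlocks_apply₂₂]
        simp [hA _ (hmem a), hM]
    rw [this, Matrix.det_fromBlocks_zero₁₂, Matrix.det_one, one_mul]
  rw [Matrix.det_submatrix_equiv_self] at hC
  have hs : B.submatrix (shuffle I hI hIc) (shuffle J hJ hJc) =
      (B.submatrix (shuffle I hI hIc) id).submatrix id (shuffle J hJ hJc) := rfl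
  rw [hs, Matrix.det_permute', Matrix.det_permute, sign_shuffle, sign_shuffle] at hC
  rw [← hC]
  push_cast
  simp only [sum_add_distrib, pow_add]
  rcases neg_one_pow_eq_or R (∑ k, (I k : ℕ)) with h₁ | h₁ <;>
    rcases neg_one_pow_eq_or R (∑ k, (J k : ℕ)) with h₂ | h₂ <;>
    rcases neg_one_pow_eq_or R (∑ k : Fin p, (k : ℕ)) with h₃ | h₃ <;>
    rcases neg_one_pow_eq_or R (∑ _k : Fin p, 1) with h₄ | h₄ <;>
    simp only [h₁, h₂, h₃, h₄] <;> ring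

section PairAlgebra

variable {R C : Type*} [CommRing R] [CommRing C] [Algebra R C] {n : ℕ}

/-- The linear combination of the `i`-th row of `b` with coefficients `w`. -/
def rowSum (b : Fin n → Fin n → C) (i : Fin n) : (Fin n → R) →ₗ[R] C :=
  Fintype.linearCombination R (b i)

theorem rowSum_apply (b : Fin n → Fin n → C) (i : Fin n) (w : Fin n → R) :
    rowSum b i w = ∑ j, w j • b i j := rfl

theorem rowSum_single (b : Fin n → Fin n → C) (i j : Fin n) :
    rowSum b i (Pi.single j (1 : R)) = b i j := by
  simp [rowSum_apply, Pi.single_apply]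

theorem rowSum_mul_rowSum_row (b : Fin n → Fin n → C) (hrow : ∀ i j l, b i j * b i l = 0)
    (i : Fin n) (v w : Fin n → R) : rowSum b i v * rowSum b i w = 0 := by
  simp [rowSum_apply, sum_mul_sum, hrow]

theorem rowSum_mul_rowSum_self (b : Fin n → Fin n → C) (hcol : ∀ i k j, b i j * b k j = 0)
    (hswap : ∀ i j k l, b i j * b k l = -(b i l * b k j))
    (i k : Fin n) (w : Fin n → R) : rowSum b i w * rowSum b k w = 0 := by
  rw [rowSum_apply, rowSum_apply, sum_mul_sum, ← sum_product']
  refine sum_involution (fun q _ => q.swap) ?_ ?_ (by simp) (by simp)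
  · rintro ⟨j, l⟩ -
    simp [hswap i j k l, smul_smul, mul_comm (w l)]
  · rintro ⟨j, l⟩ - h e
    obtain rfl : l = j := by simpa using congrArg Prod.fst e
    simp [hcol] at h

/-- The value of a functional on `∏ᵢ ∑ⱼ wᵢⱼ bᵢⱼ`, as an alternating map of the rows of `w`. -/
noncomputable def rowProd (b : Fin n → Fin n → C) (τ : C →ₗ[R] R)
    (hcol : ∀ i k j, b i j * b k j = 0)
    (hswap : ∀ i j k l, b i j * b k l = -(b i l * b k j)) :
    (Fin n → R) [⋀^Fin n]→ₗ[R] R :=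
  { τ.compMultilinearMap
      ((MultilinearMap.mkPiAlgebra R (Fin n) C).compLinearMap fun i => rowSum b i) with
    map_eq_zero_of_eq' := fun w i k h hik => by
      have : ∏ a, rowSum b a (w a) = 0 := by
        rw [← mul_prod_erase _ _ (mem_univ i), ← mul_prod_erase _ _
          (mem_erase.2 ⟨hik.symm, mem_univ k⟩), ← mul_assoc, h,
          rowSum_mul_rowSum_self b hcol hswap, zero_mul]
      change τ (∏ a, rowSum b a (w a)) = 0
      rw [this, map_zero] }

theorem apply_prod_rowSum (b : Fin n → Fin n → C) (τ : C →ₗ[R] R)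
    (hcol : ∀ i k j, b i j * b k j = 0)
    (hswap : ∀ i j k l, b i j * b k l = -(b i l * b k j))
    (hτ : τ (∏ i, b i i) = 1) (B : Matrix (Fin n) (Fin n) R) :
    τ (∏ i, rowSum b i (B i)) = B.det := by
  have h := congrArg (fun f => f B)
    ((rowProd b τ hcol hswap).eq_smul_basis_det (Pi.basisFun R (Fin n)))
  have h₁ : rowProd b τ hcol hswap (Pi.basisFun R (Fin n)) = 1 := by
    change τ (∏ i, rowSum b i (Pi.basisFun R (Fin n) i)) = 1
    simpa [rowSum_single] using hτ
  rw [h₁, one_smul, Pi.basisFun_det] at h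
  exact h

theorem pow_sum_eq_zero {ι : Type*} (s : Finset ι) (x : ι → C)
    (hx : ∀ i ∈ s, x i ^ 2 = 0) : (∑ i ∈ s, x i) ^ (#s + 1) = 0 := by
  classical
  induction s using Finset.induction_on with
  | empty => simp
  | insert a s ha ih =>
    rw [sum_insert ha, card_insert_of_notMem ha]
    exact (Commute.all _ _).add_pow_eq_zero_of_add_le_succ_of_pow_eq_zero
      (hx a (mem_insert_self _ _)) (ih fun i hi => hx i (mem_insert_of_mem hi)) (by omega)

theorem exp_sum_of_sq_eq_zero [Algebra ℚ C] {ι : Type*} (s : Finset ι) (x : ι → C)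
    (hx : ∀ i ∈ s, x i ^ 2 = 0) :
    IsNilpotent.exp (∑ i ∈ s, x i) = ∏ i ∈ s, (1 + x i) := by
  classical
  induction s using Finset.induction_on with
  | empty => simp
  | insert a s ha ih =>
    have hs : ∀ i ∈ s, x i ^ 2 = 0 := fun i hi => hx i (mem_insert_of_mem hi)
    have h := hx a (mem_insert_self _ _)
    rw [sum_insert ha, prod_insert ha, ← ih hs, IsNilpotent.exp_add_of_commute (Commute.all _ _)
      ⟨_, h⟩ ⟨_, pow_sum_eq_zero s x hs⟩, IsNilpotent.exp_eq_sum h]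
    simp [sum_range_succ]

theorem sum_range_pow_eq_prod [Algebra ℚ R] {ι : Type*} (s : Finset ι) (x : ι → C)
    (hx : ∀ i ∈ s, x i ^ 2 = 0) {N : ℕ} (hN : #s < N) :
    ∑ k ∈ range N, algebraMap ℚ R ((k.factorial : ℚ))⁻¹ • (∑ i ∈ s, x i) ^ k =
      ∏ i ∈ s, (1 + x i) := by
  let : Algebra ℚ C := ((algebraMap R C).comp (algebraMap ℚ R)).toAlgebra
  rw [← exp_sum_of_sq_eq_zero s x hx,
    IsNilpotent.exp_eq_sum (pow_eq_zero_of_le hN (pow_sum_eq_zero s x hx))]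
  refine sum_congr rfl fun k _ => ?_
  rw [Algebra.smul_def, Algebra.smul_def]
  rfl

theorem apply_prod_mul_exp [Algebra ℚ R] {p m : ℕ} (b : Fin n → Fin n → C) (τ : C →ₗ[R] R)
    (hrow : ∀ i j l, b i j * b i l = 0) (hcol : ∀ i k j, b i j * b k j = 0)
    (hswap : ∀ i j k l, b i j * b k l = -(b i l * b k j))
    (hτ : τ (∏ i, b i i) = 1)
    (hdeg : ∀ (s : Finset (Fin n)) (w : Fin n → Fin n → R), s ≠ univ →
      τ (∏ i ∈ s, rowSum b i (w i)) = 0)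
    (hn : n = p + m) (A : Matrix (Fin n) (Fin n) R)
    (I J : Fin p → Fin n) (hI : StrictMono I) (hJ : StrictMono J)
    (hIc : ((univ.image I)ᶜ : Finset (Fin n)).card = m)
    (hJc : ((univ.image J)ᶜ : Finset (Fin n)).card = m) :
    τ ((∏ k, b (I k) (J k)) * ∑ k ∈ range (2 * n + 1),
        algebraMap ℚ R ((k.factorial : ℚ))⁻¹ • (∑ i, rowSum b i (A i)) ^ k) =
      (-1 : R) ^ ((∑ k, ((I k : ℕ) + 1)) + ∑ k, ((J k : ℕ) + 1)) *
      (A.submatrix (fun a : Fin m => (univ.image I)ᶜ.orderEmbOfFin hIc a)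
        (fun a : Fin m => (univ.image J)ᶜ.orderEmbOfFin hJc a)).det := by
  set B : Matrix (Fin n) (Fin n) R := Function.extend I (fun k => Pi.single (J k) 1) A with hBdef
  have hB (k : Fin p) : B (I k) = Pi.single (J k) 1 := hI.injective.extend_apply _ _ k
  have hA (i : Fin n) (hi : i ∉ univ.image I) : B i = A i :=
    Function.extend_apply' _ _ _ fun ⟨k, hk⟩ => hi (mem_image.2 ⟨k, mem_univ k, hk⟩)
  rw [← det_of_rows_eq_single hn A B I J hI hJ hIc hJc hB hA,
    ← apply_prod_rowSum b τ hcol hswap hτ B,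
    sum_range_pow_eq_prod (R := R) univ _ (fun i _ => by rw [sq, rowSum_mul_rowSum_row b hrow])
      (by rw [card_fin]; omega)]
  have hP : ∏ k, b (I k) (J k) = ∏ i ∈ univ.image I, rowSum b i (B i) := by
    rw [prod_image hI.injective.injOn]
    simp [hB, rowSum_single]
  have absorb (i : Fin n) (hi : i ∈ univ.image I) :
      rowSum b i (B i) * (1 + rowSum b i (A i)) = rowSum b i (B i) := by
    rw [mul_add, rowSum_mul_rowSum_row b hrow, mul_one, add_zero]
  rw [hP, ← prod_mul_prod_compl (univ.image I) fun i => 1 + rowSum b i (A i), ← mul_assoc,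
    ← prod_mul_distrib, prod_congr rfl absorb,
    prod_congr rfl fun i (hi : i ∈ (univ.image I)ᶜ) => by rw [← hA i (mem_compl.1 hi)],
    prod_one_add, mul_sum, map_sum, sum_eq_single_of_mem _ (mem_powerset_self _),
    prod_mul_prod_compl]
  intro s hs hne
  have hs := mem_powerset.1 hs
  have hdisj : Disjoint (univ.image I) s := disjoint_compl_right.mono_right hs
  rw [← prod_union hdisj]
  refine hdeg _ _ fun h => hne (hs.antisymm fun i hi => ?_)
  exact (mem_union.1 (h ▸ mem_univ i)).resolve_left (mem_compl.1 hi)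

end PairAlgebra

section Anticommute

variable {S : Type*} [Ring S] {a b c d : S}

theorem mul_mul_mul_swap_of_anticomm (hbc : b * c = -(c * b)) (hac : a * c = -(c * a))
    (hab : a * b = -(b * a)) : a * b * (c * d) = -(c * b * (a * d)) :=
  calc a * b * (c * d) = a * (b * c) * d := by noncomm_ring
    _ = -((a * c) * b * d) := by rw [hbc]; noncomm_ring
    _ = c * (a * b) * d := by rw [hac]; noncomm_ring
    _ = -(c * b * (a * d)) := by rw [hab]; noncomm_ring

theorem mul_mul_mul_comm_of_anticomm (hbc : b * c = -(c * b)) (hac : a * c = -(c * a))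
    (hbd : b * d = -(d * b)) (had : a * d = -(d * a)) : a * b * (c * d) = c * d * (a * b) :=
  calc a * b * (c * d) = a * (b * c) * d := by noncomm_ring
    _ = -((a * c) * (b * d)) := by rw [hbc]; noncomm_ring
    _ = -(c * (a * d) * b) := by rw [hac, hbd]; noncomm_ring
    _ = c * d * (a * b) := by rw [had]; noncomm_ring

theorem mul_mul_mul_right_eq_zero (hbc : b * c = -(c * b)) (hb : b * b = 0) :
    a * b * (c * b) = 0 :=
  calc a * b * (c * b) = a * (b * c) * b := by noncomm_ring
    _ = -(a * c * (b * b)) := by rw [hbc]; noncomm_ring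
    _ = 0 := by rw [hb, mul_zero, neg_zero]

theorem mul_mul_mul_left_eq_zero (hab : a * b = -(b * a)) (ha : a * a = 0) :
    a * b * (a * d) = 0 := by
  rw [hab, neg_mul, mul_assoc, ← mul_assoc a, ha, zero_mul, mul_zero, neg_zero]

end Anticommute

section Grassmann

variable {R : Type*} [CommRing R] {n : ℕ}

theorem gsign_union_left {T U V : Finset (Fin (2 * n))} (h : Disjoint T U) :
    gsign (T ∪ U) V = gsign T V * gsign U V := by
  rw [gsign, gsign, gsign, ← pow_add, union_product, filter_union,
    card_union_of_disjoint (disjoint_filter_filter (disjoint_product.2 (Or.inl h)))]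

theorem gsign_union_right {T U V : Finset (Fin (2 * n))} (h : Disjoint U V) :
    gsign T (U ∪ V) = gsign T U * gsign T V := by
  rw [gsign, gsign, gsign, ← pow_add, product_union, filter_union,
    card_union_of_disjoint (disjoint_filter_filter (disjoint_product.2 (Or.inr h)))]

theorem gmul_assoc (f g h : Grassmann n R) : gmul (gmul f g) h = gmul f (gmul g h) := by
  funext S
  simp only [gmul, mul_sum, sum_mul]
  rw [sum_sigma', sum_sigma']
  refine sum_bij' (fun q _ => ⟨q.2, q.1 \ q.2⟩) (fun q _ => ⟨q.1 ∪ q.2, q.1⟩) ?_ ?_ ?_ ?_ ?_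
  · rintro ⟨T, U⟩ hq
    simp only [mem_sigma, mem_powerset] at hq ⊢
    exact ⟨hq.2.trans hq.1, sdiff_subset_sdiff hq.1 le_rfl⟩
  · rintro ⟨U, V⟩ hq
    simp only [mem_sigma, mem_powerset] at hq ⊢
    exact ⟨union_subset hq.1 (hq.2.trans sdiff_subset), subset_union_left⟩
  · rintro ⟨T, U⟩ hq
    simp only [mem_sigma, mem_powerset] at hq
    simp [union_sdiff_of_subset hq.2]
  · rintro ⟨U, V⟩ hq
    simp only [mem_sigma, mem_powerset] at hq
    have : Disjoint U V := disjoint_sdiff.mono_right hq.2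
    simp [union_sdiff_cancel_left this]
  · rintro ⟨T, U⟩ hq
    simp only [mem_sigma, mem_powerset] at hq
    obtain ⟨hT, hU⟩ := hq
    have e₁ : (S \ U) \ (T \ U) = S \ T := by
      ext x
      have := @hU x
      simp only [mem_sdiff]
      tauto
    have e₂ : S \ U = (T \ U) ∪ (S \ T) := by
      ext x
      have := @hU x
      have := @hT x
      simp only [mem_sdiff, mem_union]
      tauto
    have s₁ : gsign T (S \ T) = gsign U (S \ T) * gsign (T \ U) (S \ T) := by
      rw [← gsign_union_left disjoint_sdiff, union_sdiff_of_subset hU]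
    have s₂ : gsign U (S \ U) = gsign U (T \ U) * gsign U (S \ T) := by
      rw [e₂, gsign_union_right (disjoint_sdiff.mono_left sdiff_subset)]
    dsimp only
    rw [e₁, s₁, s₂]
    push_cast
    ring

/-- Left multiplication in the Grassmann algebra. -/
def gmulLeft (f : Grassmann n R) : Module.End R (Grassmann n R) where
  toFun := gmul f
  map_add' g h := by
    funext S
    simp [gmul, mul_add, sum_add_distrib]
  map_smul' c g := by
    funext S
    simp only [gmul, Pi.smul_apply, smul_eq_mul, mul_sum, RingHom.id_apply]
    exact sum_congr rfl fun _ _ => by ring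

theorem gmulLeft_apply (f g : Grassmann n R) : gmulLeft f g = gmul f g := rfl

theorem gmulLeft_gmul (f g : Grassmann n R) :
    gmulLeft (gmul f g) = gmulLeft f * gmulLeft g :=
  LinearMap.ext fun h => gmul_assoc f g h

theorem gmulLeft_linear (f g : Grassmann n R) (c : R) :
    gmulLeft (c • f + g) = c • gmulLeft f + gmulLeft g := by
  refine LinearMap.ext fun h => funext fun S => ?_
  simp only [gmulLeft_apply, LinearMap.add_apply, LinearMap.smul_apply, Pi.add_apply,
    Pi.smul_apply, smul_eq_mul, gmul, mul_sum, ← sum_add_distrib]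
  exact sum_congr rfl fun _ _ => by ring

variable (R n) in
/-- `gmulLeft` as a linear map. -/
def gmulLeftₗ : Grassmann n R →ₗ[R] Module.End R (Grassmann n R) where
  toFun := gmulLeft
  map_add' f g := by simpa using gmulLeft_linear f g 1
  map_smul' c f := by
    have h0 : gmulLeft (0 : Grassmann n R) = 0 := by
      refine LinearMap.ext fun h => funext fun S => ?_
      simp [gmulLeft_apply, gmul]
    simpa [h0] using gmulLeft_linear f 0 c

variable (R) in
/-- The monomial given by the product, in increasing order, of the generators in `T`. -/
def monomial (T : Finset (Fin (2 * n))) : Grassmann n R := fun S => if S = T then 1 else 0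

theorem gmul_monomial (T U : Finset (Fin (2 * n))) :
    gmul (monomial R T) (monomial R U) =
      if Disjoint T U then (gsign T U : R) • monomial R (T ∪ U) else 0 := by
  funext S
  simp only [gmul, monomial, mul_ite, mul_one, mul_zero]
  split_ifs with h
  · simp only [Pi.smul_apply, smul_eq_mul, monomial, mul_ite, mul_one, mul_zero]
    split_ifs with hS
    · subst hS
      rw [sum_eq_single_of_mem T (mem_powerset.2 subset_union_left)]
      · simp [union_sdiff_cancel_left h]
      · intro V _ hV
        simp [hV]
    · refine sum_eq_zero fun V hV => ?_
      split_ifs with h₁ h₂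
      · exact absurd (by rw [← h₁, ← h₂, union_sdiff_of_subset (mem_powerset.1 hV)]) hS
      all_goals rfl
  · refine sum_eq_zero fun V hV => ?_
    split_ifs with h₁ h₂
    · exact absurd (h₁ ▸ h₂ ▸ disjoint_sdiff) h
    all_goals rfl

theorem gone_gmul (f : Grassmann n R) : gmul gone f = f := by
  funext S
  simp only [gmul, gone]
  rw [sum_eq_single_of_mem ∅ (empty_mem_powerset S)]
  · simp [gsign]
  · intro T _ hT
    simp [hT]

theorem gmul_generator_self (a : Fin (2 * n)) :
    gmul (monomial R {a}) (monomial R {a}) = 0 := by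
  simp [gmul_monomial]

theorem gmul_generator_comm (a b : Fin (2 * n)) :
    gmul (monomial R {a}) (monomial R {b}) = -gmul (monomial R {b}) (monomial R {a}) := by
  rcases eq_or_ne a b with rfl | hab
  · simp [gmul_generator_self]
  rw [gmul_monomial, gmul_monomial, if_pos (by simpa using hab), if_pos (by simpa using hab.symm),
    union_comm, ← neg_smul]
  congr 1
  rcases lt_or_gt_of_ne hab with h | h <;> simp [gsign, filter_singleton, h, h.not_gt]

theorem psi_eq_monomial (i : Fin n) :
    (psi i : Grassmann n R) = monomial R {⟨2 * i.1, by have := i.2; omega⟩} := rfl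

theorem psibar_eq_monomial (i : Fin n) :
    (psibar i : Grassmann n R) = monomial R {⟨2 * i.1 + 1, by have := i.2; omega⟩} := rfl

variable (R) in
/-- Left multiplication by `ψⱼψ̄ᵢ`. -/
def pairOp (i j : Fin n) : Module.End R (Grassmann n R) := gmulLeft (gmul (psi j) (psibar i))

theorem mul_generator_comm (a b : Fin (2 * n)) :
    gmulLeft (monomial R {a}) * gmulLeft (monomial R {b}) =
      -(gmulLeft (monomial R {b}) * gmulLeft (monomial R {a})) := by
  rw [← gmulLeft_gmul, ← gmulLeft_gmul, gmul_generator_comm]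
  exact map_neg (gmulLeftₗ R n) _

theorem mul_generator_self (a : Fin (2 * n)) :
    gmulLeft (monomial R {a}) * gmulLeft (monomial R {a}) = 0 := by
  rw [← gmulLeft_gmul, gmul_generator_self]
  exact map_zero (gmulLeftₗ R n)

theorem pairOp_eq (i j : Fin n) :
    pairOp R i j = gmulLeft (psi j) * gmulLeft (psibar i) := gmulLeft_gmul _ _

theorem pairOp_swap (i j k l : Fin n) :
    pairOp R i j * pairOp R k l = -(pairOp R i l * pairOp R k j) := by
  simp only [pairOp_eq, psi_eq_monomial, psibar_eq_monomial]
  exact mul_mul_mul_swap_of_anticomm (mul_generator_comm _ _) (mul_generator_comm _ _)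
    (mul_generator_comm _ _)

theorem pairOp_comm (i j k l : Fin n) :
    pairOp R i j * pairOp R k l = pairOp R k l * pairOp R i j := by
  simp only [pairOp_eq, psi_eq_monomial, psibar_eq_monomial]
  exact mul_mul_mul_comm_of_anticomm (mul_generator_comm _ _) (mul_generator_comm _ _)
    (mul_generator_comm _ _) (mul_generator_comm _ _)

theorem pairOp_mul_row (i j l : Fin n) : pairOp R i j * pairOp R i l = 0 := by
  simp only [pairOp_eq, psi_eq_monomial, psibar_eq_monomial]
  exact mul_mul_mul_right_eq_zero (mul_generator_comm _ _) (mul_generator_self _)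

theorem pairOp_mul_col (i k j : Fin n) : pairOp R i j * pairOp R k j = 0 := by
  simp only [pairOp_eq, psi_eq_monomial, psibar_eq_monomial]
  exact mul_mul_mul_left_eq_zero (mul_generator_comm _ _) (mul_generator_self _)

theorem gmul_psi_psibar (i j : Fin n) :
    gmul (psi j) (psibar i) = -gmul (psibar i) (psi j : Grassmann n R) :=
  gmul_generator_comm _ _

theorem gmulLeft_neg_quadForm (A : Matrix (Fin n) (Fin n) R) :
    gmulLeft (-quadForm A) = ∑ i, ∑ j, A i j • pairOp R i j := by
  have : -quadForm A = ∑ i, ∑ j, A i j • gmul (psi j) (psibar i) := by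
    funext S
    simp [quadForm, gmul_psi_psibar, Finset.sum_apply]
  rw [this]
  exact (map_sum (gmulLeftₗ R n) _ _).trans <| sum_congr rfl fun i _ =>
    (map_sum (gmulLeftₗ R n) _ _).trans <| sum_congr rfl fun j _ =>
      map_smul (gmulLeftₗ R n) _ _

theorem gmulLeft_gprodList (l : List (Grassmann n R)) :
    gmulLeft (gprodList l) = (l.map gmulLeft).prod := by
  induction l with
  | nil => exact LinearMap.ext gone_gmul
  | cons f l ih => rw [gprodList, gmulLeft_gmul, ih, List.map_cons, List.prod_cons]

theorem gpow_eq (f : Grassmann n R) (k : ℕ) : gpow f k = (gmulLeft f ^ k) gone := by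
  induction k with
  | zero => rfl
  | succ k ih => rw [pow_succ', Module.End.mul_apply, ← ih]; rfl

theorem gexp_eq [Algebra ℚ R] (f : Grassmann n R) :
    gexp f = (∑ k ∈ range (2 * n + 1),
      algebraMap ℚ R ((k.factorial : ℚ))⁻¹ • gmulLeft f ^ k) gone := by
  funext S
  simp only [gexp, gpow_eq, LinearMap.sum_apply, LinearMap.smul_apply, Finset.sum_apply,
    Pi.smul_apply, smul_eq_mul]

/-- The elements all of whose monomials have degree `d`. -/
def homogeneous (R : Type*) [CommRing R] (n d : ℕ) : Submodule R (Grassmann n R) where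
  carrier := {f | ∀ S, #S ≠ d → f S = 0}
  add_mem' hf hg S hS := by simp [hf S hS, hg S hS]
  zero_mem' _ _ := rfl
  smul_mem' c f hf S hS := by simp [hf S hS]

theorem gmul_mem_homogeneous {c d : ℕ} {f g : Grassmann n R} (hf : f ∈ homogeneous R n c)
    (hg : g ∈ homogeneous R n d) : gmul f g ∈ homogeneous R n (c + d) := by
  intro S hS
  refine sum_eq_zero fun T hT => ?_
  by_cases hc : #T = c
  · rw [hg (S \ T), mul_zero]
    rw [card_sdiff_of_subset (mem_powerset.1 hT)]
    have := card_le_card (mem_powerset.1 hT)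
    omega
  · rw [hf T hc, mul_zero, zero_mul]

theorem monomial_mem_homogeneous (T : Finset (Fin (2 * n))) :
    monomial R T ∈ homogeneous R n #T := by
  intro S hS
  rw [monomial, if_neg]
  rintro rfl
  exact hS rfl

theorem pairOp_mem_homogeneous (i j : Fin n) {d : ℕ} {f : Grassmann n R}
    (hf : f ∈ homogeneous R n d) : pairOp R i j f ∈ homogeneous R n (2 + d) := by
  have h := gmul_mem_homogeneous
    (monomial_mem_homogeneous (R := R) (n := n) {⟨2 * j.1, by have := j.2; omega⟩})
    (monomial_mem_homogeneous (n := n) {⟨2 * i.1 + 1, by have := i.2; omega⟩})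
  rw [card_singleton, card_singleton] at h
  exact gmul_mem_homogeneous h hf

variable (n) in
/-- The set `{ψᵢ, ψ̄ᵢ}` of generators with index in `s`. -/
def pairSet (s : Finset (Fin n)) : Finset (Fin (2 * n)) := {a | (⟨a / 2, by omega⟩ : Fin n) ∈ s}

theorem pairOp_monomial_pairSet {s : Finset (Fin n)} {i : Fin n} (hi : i ∉ s) :
    pairOp R i i (monomial R (pairSet n s)) = monomial R (pairSet n (insert i s)) := by
  set a : Fin (2 * n) := ⟨2 * i.1, by have := i.2; omega⟩ with ha
  set b : Fin (2 * n) := ⟨2 * i.1 + 1, by have := i.2; omega⟩ with hb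
  have hlt : a < b := by simp [ha, hb, Fin.lt_def]
  have mem_iff (c : Fin (2 * n)) : (⟨c / 2, by omega⟩ : Fin n) = i ↔ c = a ∨ c = b := by
    simp only [Fin.ext_iff, ha, hb]
    omega
  have hab (c) (hc : c ∈ pairSet n s) : c ≠ a ∧ c ≠ b := by
    rw [← not_or, ← mem_iff]
    intro h
    exact hi (h ▸ (mem_filter.1 hc).2)
  have hda : a ∉ pairSet n s := fun h => (hab _ h).1 rfl
  have hdb : b ∉ pairSet n s := fun h => (hab _ h).2 rfl
  have hunion : {a} ∪ ({b} ∪ pairSet n s) = pairSet n (insert i s) := by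
    ext c
    simp only [pairSet, mem_union, mem_singleton, mem_filter, mem_univ, true_and, mem_insert,
      mem_iff, or_assoc]
  have hsign : gsign {b} (pairSet n s) * gsign {a} ({b} ∪ pairSet n s) = 1 := by
    rw [gsign_union_right (by simpa using hdb)]
    have h₁ : gsign {a} {b} = 1 := by simp [gsign, filter_singleton, hlt.not_gt]
    have h₂ : gsign {a} (pairSet n s) = gsign {b} (pairSet n s) := by
      unfold gsign
      simp only [singleton_product, filter_map, card_map]
      congr 2
      refine filter_congr fun c hc => ?_
      have := hab c hc
      simp only [ne_eq, Fin.ext_iff, ha, hb] at this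
      simp only [Function.comp_apply, Function.Embedding.coeFn_mk, Fin.lt_def, ha, hb]
      omega
    rw [h₁, h₂, one_mul, gsign, ← mul_pow]
    simp
  rw [pairOp_eq, Module.End.mul_apply, psi_eq_monomial, psibar_eq_monomial, gmulLeft_apply,
    gmulLeft_apply, gmul_monomial, if_pos (by simpa using hdb), ← gmulLeft_apply, map_smul,
    gmulLeft_apply, gmul_monomial, if_pos (by simpa [hlt.ne] using hda), smul_smul, hunion,
    ← Int.cast_mul, hsign, Int.cast_one, one_smul]

variable (R n) in
/-- The subalgebra generated by the operators `pairOp`. -/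
abbrev pairAlgebra : Subalgebra R (Module.End R (Grassmann n R)) :=
  Algebra.adjoin R (Set.range fun q : Fin n × Fin n => pairOp R q.1 q.2)

instance : IsMulCommutative (pairAlgebra R n) :=
  Algebra.isMulCommutative_adjoin R <| by
    rintro _ ⟨p, rfl⟩ _ ⟨q, rfl⟩
    exact pairOp_comm _ _ _ _

open scoped IsMulCommutative

variable (R) in
/-- `pairOp` as an element of the commutative algebra `pairAlgebra`. -/
def pairElt (i j : Fin n) : pairAlgebra R n :=
  ⟨pairOp R i j, Algebra.subset_adjoin ⟨(i, j), rfl⟩⟩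

variable (R n) in
/-- The Berezin integral of the Grassmann element represented by an operator. -/
def pairIntegral : pairAlgebra R n →ₗ[R] R where
  toFun c := berezin ((c : Module.End R (Grassmann n R)) gone)
  map_add' _ _ := rfl
  map_smul' _ _ := rfl

theorem coe_rowSum_pairElt (i : Fin n) (w : Fin n → R) :
    (rowSum (pairElt R) i w : Module.End R (Grassmann n R)) = ∑ j, w j • pairOp R i j := by
  rw [rowSum_apply, AddSubmonoidClass.coe_finsetSum]
  rfl

theorem prod_rowSum_mem_homogeneous (s : Finset (Fin n)) (w : Fin n → Fin n → R) :
    ((∏ i ∈ s, rowSum (pairElt R) i (w i) : pairAlgebra R n) : Module.End R (Grassmann n R)) gone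
      ∈ homogeneous R n (2 * #s) := by
  induction s using Finset.induction_on with
  | empty => exact monomial_mem_homogeneous ∅
  | insert a s ha ih =>
    rw [prod_insert ha, MulMemClass.coe_mul, Module.End.mul_apply, coe_rowSum_pairElt,
      LinearMap.sum_apply, card_insert_of_notMem ha, mul_add, add_comm]
    exact sum_mem fun j _ => Submodule.smul_mem _ _ (pairOp_mem_homogeneous _ _ ih)

theorem pairIntegral_prod_rowSum_eq_zero (s : Finset (Fin n)) (w : Fin n → Fin n → R)
    (hs : s ≠ univ) : pairIntegral R n (∏ i ∈ s, rowSum (pairElt R) i (w i)) = 0 := by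
  refine prod_rowSum_mem_homogeneous s w univ ?_
  have := (card_lt_iff_ne_univ s).2 hs
  rw [Fintype.card_fin] at this
  rw [card_fin]
  omega

theorem prod_pairElt_gone (s : Finset (Fin n)) :
    ((∏ i ∈ s, pairElt R i i : pairAlgebra R n) : Module.End R (Grassmann n R)) gone =
      monomial R (pairSet n s) := by
  induction s using Finset.induction_on with
  | empty => simp [pairSet]; rfl
  | insert a s ha ih =>
    rw [prod_insert ha, MulMemClass.coe_mul, Module.End.mul_apply, ih]
    exact pairOp_monomial_pairSet ha

theorem pairIntegral_prod_diag : pairIntegral R n (∏ i, pairElt R i i) = 1 := by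
  change berezin (((∏ i, pairElt R i i : pairAlgebra R n) : Module.End R (Grassmann n R)) gone) = 1
  rw [prod_pairElt_gone]
  simp [berezin, monomial, pairSet]

theorem berezin_gprodList_gmul_gexp [Algebra ℚ R] {p : ℕ} (A : Matrix (Fin n) (Fin n) R)
    (I J : Fin p → Fin n) :
    berezin (gmul (gprodList (List.ofFn fun k : Fin p => gmul (psi (J k)) (psibar (I k))))
        (gexp (-quadForm A))) =
      pairIntegral R n ((∏ k, pairElt R (I k) (J k)) * ∑ k ∈ range (2 * n + 1),
        algebraMap ℚ R ((k.factorial : ℚ))⁻¹ •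
          (∑ i, rowSum (R := R) (pairElt R (n := n)) i (A i)) ^ k) := by
  have h₁ : ((∏ k, pairElt R (I k) (J k) : pairAlgebra R n) : Module.End R (Grassmann n R)) =
      gmulLeft (gprodList (List.ofFn fun k : Fin p => gmul (psi (J k)) (psibar (I k)))) := by
    rw [gmulLeft_gprodList, ← List.prod_ofFn, SubmonoidClass.coe_list_prod, List.map_ofFn,
      List.map_ofFn]
    rfl
  have h₂ : ((∑ i, rowSum (R := R) (pairElt R (n := n)) i (A i) : pairAlgebra R n) :
      Module.End R (Grassmann n R)) = gmulLeft (-quadForm A) := by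
    rw [gmulLeft_neg_quadForm, AddSubmonoidClass.coe_finsetSum]
    exact sum_congr rfl fun i _ => coe_rowSum_pairElt i (A i)
  have h₃ : ((∑ k ∈ range (2 * n + 1), algebraMap ℚ R ((k.factorial : ℚ))⁻¹ •
      (∑ i, rowSum (R := R) (pairElt R (n := n)) i (A i)) ^ k : pairAlgebra R n) :
      Module.End R (Grassmann n R)) = ∑ k ∈ range (2 * n + 1),
        algebraMap ℚ R ((k.factorial : ℚ))⁻¹ • gmulLeft (-quadForm A) ^ k := by
    rw [AddSubmonoidClass.coe_finsetSum, ← h₂]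
    rfl
  rw [← gmulLeft_apply, gexp_eq, ← h₁, ← h₃, ← Module.End.mul_apply, ← MulMemClass.coe_mul]
  rfl

theorem berezin_gmul_gexp [Algebra ℚ R] {p m : ℕ} (hn : n = p + m)
    (A : Matrix (Fin n) (Fin n) R) (I J : Fin p → Fin n) (hI : StrictMono I) (hJ : StrictMono J)
    (hIc : ((univ.image I)ᶜ : Finset (Fin n)).card = m)
    (hJc : ((univ.image J)ᶜ : Finset (Fin n)).card = m) :
    berezin (gmul (gprodList (List.ofFn fun k : Fin p => gmul (psi (J k)) (psibar (I k))))
        (gexp (-quadForm A))) =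
      (-1 : R) ^ ((∑ k, ((I k : ℕ) + 1)) + ∑ k, ((J k : ℕ) + 1)) *
      (A.submatrix (fun a : Fin m => (univ.image I)ᶜ.orderEmbOfFin hIc a)
        (fun a : Fin m => (univ.image J)ᶜ.orderEmbOfFin hJc a)).det := by
  rw [berezin_gprodList_gmul_gexp]
  have hrow (i j l : Fin n) : pairElt R i j * pairElt R i l = 0 :=
    Subtype.ext (pairOp_mul_row i j l)
  have hcol (i k j : Fin n) : pairElt R i j * pairElt R k j = 0 :=
    Subtype.ext (pairOp_mul_col i k j)
  have hswap (i j k l : Fin n) :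
      pairElt R i j * pairElt R k l + pairElt R i l * pairElt R k j = 0 :=
    Subtype.ext (eq_neg_iff_add_eq_zero.1 (pairOp_swap i j k l))
  exact apply_prod_mul_exp (pairElt R) (pairIntegral R n) hrow hcol
    (fun i j k l => eq_neg_of_add_eq_zero_left (hswap i j k l))
    pairIntegral_prod_diag pairIntegral_prod_rowSum_eq_zero hn A I J hI hJ hIc hJc

end Grassmann

/-- Generalized Berezin–Cramér identity: for an `n×n` matrix `A` and strictly increasing
index families `I = {i₁<⋯<i_p}`, `J = {j₁<⋯<j_p}`,
`∫ dψ̄ dψ (ψ_{j₁}ψ̄_{i₁}⋯ψ_{j_p}ψ̄_{i_p}) e^{−ψ̄Aψ} = (−1)^{ΣI+ΣJ} det(A^{I,J})`,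
where `A^{I,J}` is `A` with the rows in `I` and the columns in `J` deleted, and
`ΣI = i₁+⋯+i_p` (indices counted starting from 1). -/
theorem berezin_minor {R : Type*} [CommRing R] [Algebra ℚ R] {n p : ℕ}
    (A : Matrix (Fin n) (Fin n) R)
    (I J : Fin p → Fin n) (hI : StrictMono I) (hJ : StrictMono J)
    (hIc : ((Finset.univ.image I)ᶜ : Finset (Fin n)).card = n - p)
    (hJc : ((Finset.univ.image J)ᶜ : Finset (Fin n)).card = n - p) :
    berezin (gmul
        (gprodList (List.ofFn fun k : Fin p => gmul (psi (J k)) (psibar (I k))))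
        (gexp (-quadForm A)))
      = (-1 : R) ^ ((∑ k, ((I k : ℕ) + 1)) + ∑ k, ((J k : ℕ) + 1)) *
        (A.submatrix
          (fun a : Fin (n - p) =>
            (((Finset.univ.image I)ᶜ : Finset (Fin n)).orderEmbOfFin hIc a))
          (fun a : Fin (n - p) =>
            (((Finset.univ.image J)ᶜ : Finset (Fin n)).orderEmbOfFin hJc a))).det := by
  have hp : p ≤ n := by simpa using Fintype.card_le_of_injective I hI.injective
  exact berezin_gmul_gexp (by omega) A I J hI hJ hIc hJc
end

section
/- The Moyal quartic interaction is real and nonnegative: for a real-valued Schwartz function φ on ℝ⁴, the integral ∫∏_{i=1}^4 dx_i φ(x_i) δ(x₁−x₂+x₃−x₄) e^{iφ̃} with phase φ̃ = ∑_{i<j}(−1)^{i+j+1} x_i∧x_j equals ∫ dk ( ∫∫ dx dy φ(x)φ(y) e^{ik·(x−y)+i x∧y} )², which is a nonnegative real number. -/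
open MeasureTheory Matrix

/-- The Moyal wedge `x ∧ y = 2 x·Θ⁻¹y` on `ℝ⁴`. -/
noncomputable def mwedge (Θ : Matrix (Fin 4) (Fin 4) ℝ) (x y : Fin 4 → ℝ) : ℝ :=
  2 * ∑ a, ∑ b, x a * Θ⁻¹ a b * y b

/-- The vertex phase `φ̃ = ∑_{i<j} (−1)^{i+j+1} xᵢ ∧ xⱼ` of the Moyal quartic
interaction. -/
noncomputable def vertexPhase (Θ : Matrix (Fin 4) (Fin 4) ℝ) (x₁ x₂ x₃ x₄ : Fin 4 → ℝ) : ℝ :=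
  mwedge Θ x₁ x₂ - mwedge Θ x₁ x₃ + mwedge Θ x₁ x₄
    + mwedge Θ x₂ x₃ - mwedge Θ x₂ x₄ + mwedge Θ x₃ x₄

open scoped FourierTransform SchwartzMap

/-- The shear `(x, y) ↦ (x, y + N x)` preserves Lebesgue measure. -/
theorem measurePreserving_prod_shear {ι : Type*} [Fintype ι] {N : (ι → ℝ) → (ι → ℝ)}
    (hN : Continuous N) :
    MeasurePreserving (fun p : (ι → ℝ) × (ι → ℝ) => (p.1, p.2 + N p.1)) :=
  (MeasurePreserving.id volume).skew_product (g := fun x y => y + N x)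
    (by fun_prop) (.of_forall fun x => map_add_right_eq_self volume (N x))

theorem MeasureTheory.Integrable.comp_prod_shear {ι : Type*} [Fintype ι]
    {G : (ι → ℝ) × (ι → ℝ) → ℂ} (hG : Integrable G) {N : (ι → ℝ) → (ι → ℝ)} (hN : Continuous N) :
    Integrable (fun p : (ι → ℝ) × (ι → ℝ) => G (p.1, p.2 + N p.1)) :=
  (measurePreserving_prod_shear hN).integrable_comp_of_integrable hG

theorem MeasureTheory.Integrable.comp_add_left_prod {ι : Type*} [Fintype ι]
    {G : (ι → ℝ) × (ι → ℝ) → ℂ} (hG : Integrable G) :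
    Integrable (fun p : (ι → ℝ) × (ι → ℝ) => G (p.1 + p.2, p.2)) :=
  (hG.swap.comp_prod_shear continuous_id).swap

/-- The substitution `x = u + y` in an iterated integral. -/
theorem integral_integral_eq_add_left {ι : Type*} [Fintype ι]
    {G : (ι → ℝ) × (ι → ℝ) → ℂ} (hG : Integrable G) :
    ∫ x, ∫ y, G (x, y) = ∫ u, ∫ y, G (u + y, y) := by
  rw [integral_integral_swap (f := fun x y => G (x, y)) hG,
    integral_integral_swap (f := fun u y => G (u + y, y)) hG.comp_add_left_prod]
  exact integral_congr_ae (.of_forall fun y =>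
    (integral_add_right_eq_self (fun x => G (x, y)) y).symm)

/-- The unnormalised Fourier integral `k ↦ ∫ e^{ik·u} g(u) du`. -/
noncomputable def fourierExp {ι : Type*} [Fintype ι] (g : (ι → ℝ) → ℂ) (k : ι → ℝ) : ℂ :=
  ∫ u, Complex.exp (Complex.I * ((k ⬝ᵥ u : ℝ) : ℂ)) * g u

theorem fourierExp_eq_fourier {ι : Type*} [Fintype ι] (g : (ι → ℝ) → ℂ) (k : ι → ℝ) :
    fourierExp g k = 𝓕 (fun v : EuclideanSpace ℝ ι => g v.ofLp)
      (WithLp.toLp 2 ((-(2 * Real.pi)⁻¹) • k)) := by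
  rw [Real.fourier_eq', fourierExp,
    ← (PiLp.volume_preserving_ofLp ι).integral_comp
      (MeasurableEquiv.toLp 2 (ι → ℝ)).symm.measurableEmbedding]
  refine integral_congr_ae (.of_forall fun v => ?_)
  have h : -2 * Real.pi * inner ℝ v (WithLp.toLp 2 ((-(2 * Real.pi)⁻¹) • k)) = k ⬝ᵥ v.ofLp := by
    have := Real.pi_ne_zero
    simp only [PiLp.inner_apply, dotProduct, Finset.mul_sum]
    refine Finset.sum_congr rfl fun i _ => ?_
    simp
    field_simp
  simp only [h, smul_eq_mul, mul_comm Complex.I]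

theorem integrable_fourier_of_integrable_fourierExp {ι : Type*} [Fintype ι] {g : (ι → ℝ) → ℂ}
    (hg : Integrable (fourierExp g)) :
    Integrable (𝓕 (fun v : EuclideanSpace ℝ ι => g v.ofLp)) := by
  rw [← (PiLp.volume_preserving_toLp ι).integrable_comp_emb
    (MeasurableEquiv.toLp 2 (ι → ℝ)).measurableEmbedding]
  refine (integrable_comp_smul_iff volume _ (R := -(2 * Real.pi)⁻¹)
    (by simp [Real.pi_ne_zero])).1 ?_
  exact hg.congr (.of_forall fun k => fourierExp_eq_fourier g k)

/-- The Fourier transform of a Schwartz function is integrable. -/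
theorem SchwartzMap.integrable_fourierExp {ι : Type*} [Fintype ι] (φ : 𝓢(ι → ℝ, ℝ)) :
    Integrable (fourierExp fun u => (φ u : ℂ)) := by
  let ψ : 𝓢(EuclideanSpace ℝ ι, ℂ) :=
    (φ.postcompCLM Complex.ofRealCLM).compCLMOfContinuousLinearEquiv ℝ
      (EuclideanSpace.equiv ι ℝ)
  have h1 : Integrable (𝓕 (fun v : EuclideanSpace ℝ ι => (φ v.ofLp : ℂ))) :=
    (𝓕 ψ).integrable
  rw [← (PiLp.volume_preserving_toLp ι).integrable_comp_emb
    (MeasurableEquiv.toLp 2 (ι → ℝ)).measurableEmbedding] at h1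
  exact (h1.comp_smul (R := -(2 * Real.pi)⁻¹) (by simp [Real.pi_ne_zero])).congr
    (.of_forall fun k => (fourierExp_eq_fourier (fun u => (φ u : ℂ)) k).symm)

/-- Parseval's identity for the bilinear pairing of `g` with its reflection. -/
theorem integral_fourierExp_sq {ι : Type*} [Fintype ι] {g : (ι → ℝ) → ℂ} (hc : Continuous g)
    (hg : Integrable g) (hF : Integrable (fourierExp g)) :
    ∫ k, fourierExp g k ^ 2 = (((2 * Real.pi) ^ Fintype.card ι : ℝ) : ℂ) * ∫ u, g u * g (-u) := by
  set h : EuclideanSpace ℝ ι → ℂ := fun v => g v.ofLp with hdef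
  have hhc : Continuous h := by fun_prop
  have hh : Integrable h := (PiLp.volume_preserving_ofLp ι).integrable_comp_of_integrable hg
  have hFh : Integrable (𝓕 h) := integrable_fourier_of_integrable_fourierExp hF
  have inv (v) : 𝓕 (𝓕 h) v = h (-v) := by
    rw [← hhc.fourierInv_fourier_eq hh hFh, Real.fourierInv_eq_fourier_neg, neg_neg,
      hhc.fourierInv_fourier_eq hh hFh]
  have parseval : ∫ v, 𝓕 h v * 𝓕 h v = ∫ v, h v * h (-v) := by
    simp only [← inv]
    simpa using! VectorFourier.integral_fourierIntegral_smul_eq_flip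
      (L := innerₗ (EuclideanSpace ℝ ι)) Real.continuous_fourierChar continuous_inner hh hFh
  have h1 := (PiLp.volume_preserving_ofLp ι).integral_comp
      (MeasurableEquiv.toLp 2 (ι → ℝ)).symm.measurableEmbedding (fun u => g u * g (-u))
  have h2 := (PiLp.volume_preserving_toLp ι).integral_comp
      (MeasurableEquiv.toLp 2 (ι → ℝ)).measurableEmbedding (fun v => 𝓕 h v * 𝓕 h v)
  have h3 := Measure.integral_comp_smul volume
    (fun k : ι → ℝ => 𝓕 h (WithLp.toLp 2 k) * 𝓕 h (WithLp.toLp 2 k)) (-(2 * Real.pi)⁻¹)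
  simp only [fourierExp_eq_fourier, pow_two (_ : ℂ), ← hdef]
  rw [h3, h2, parseval, ← h1]
  have : |((-(2 * Real.pi)⁻¹) ^ Fintype.card ι)⁻¹| = (2 * Real.pi) ^ Fintype.card ι := by
    rw [abs_inv, abs_pow, abs_neg, abs_inv, abs_of_pos Real.two_pi_pos, inv_pow, inv_inv]
  rw [Module.finrank_fintype_fun_eq_card, this, Complex.real_smul]
  rfl

theorem Matrix.dotProduct_mulVec_of_transpose_eq_neg {ι : Type*} [Fintype ι] {A : Matrix ι ι ℝ}
    (hA : Aᵀ = -A) (x y : ι → ℝ) : x ⬝ᵥ A *ᵥ y = -(y ⬝ᵥ A *ᵥ x) := by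
  rw [dotProduct_mulVec, ← mulVec_transpose, hA, neg_mulVec, neg_dotProduct, dotProduct_comm]

theorem Matrix.dotProduct_mulVec_self_of_transpose_eq_neg {ι : Type*} [Fintype ι]
    {A : Matrix ι ι ℝ} (hA : Aᵀ = -A) (x : ι → ℝ) : x ⬝ᵥ A *ᵥ x = 0 := by
  linarith [dotProduct_mulVec_of_transpose_eq_neg hA x x]

theorem norm_mul_exp_I_mul (a t : ℝ) :
    ‖(a : ℂ) * Complex.exp (Complex.I * (t : ℂ))‖ = ‖a‖ := by
  rw [norm_mul, mul_comm Complex.I, Complex.norm_exp_ofReal_mul_I, mul_one, Complex.norm_real]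

theorem MeasureTheory.Integrable.mul_exp_I {α : Type*} [MeasurableSpace α] {μ : Measure α}
    {f : α → ℂ} (hf : Integrable f μ) {t : α → ℝ} (ht : Measurable t) :
    Integrable (fun x => f x * Complex.exp (Complex.I * (t x : ℂ))) μ :=
  hf.mul_bdd (c := 1) (by fun_prop) (.of_forall fun x => by
    rw [mul_comm Complex.I, Complex.norm_exp_ofReal_mul_I])

section TwistedCorrelation

variable {ι : Type*} [Fintype ι]

/-- The phase-twisted autocorrelation `u ↦ ∫ φ(u + y) φ(y) e^{i u·Ay} dy`. -/
noncomputable def twistedCorr (A : Matrix ι ι ℝ) (φ : 𝓢(ι → ℝ, ℝ)) (u : ι → ℝ) : ℂ :=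
  ∫ y, ((φ (u + y) * φ y : ℝ) : ℂ) * Complex.exp (Complex.I * ((u ⬝ᵥ A *ᵥ y : ℝ) : ℂ))

theorem SchwartzMap.integrable_mul_exp_prod (φ : 𝓢(ι → ℝ, ℝ))
    {t : (ι → ℝ) × (ι → ℝ) → ℝ} (ht : Measurable t) :
    Integrable (fun p : (ι → ℝ) × (ι → ℝ) =>
      ((φ p.1 * φ p.2 : ℝ) : ℂ) * Complex.exp (Complex.I * (t p : ℂ))) :=
  ((φ.integrable (μ := volume)).mul_prod (φ.integrable (μ := volume))).ofReal.mul_exp_I ht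

theorem exists_norm_twistedCorr_le (A : Matrix ι ι ℝ) (φ : 𝓢(ι → ℝ, ℝ)) :
    ∃ C, ∀ u, ‖twistedCorr A φ u‖ ≤ C := by
  obtain ⟨C, hC⟩ := φ.toBoundedContinuousFunction.isBounded_range.exists_norm_le
  refine ⟨∫ y, C * ‖φ y‖, fun u => norm_integral_le_of_norm_le
    ((φ.integrable (μ := volume)).norm.const_mul C) (.of_forall fun y => ?_)⟩
  rw [norm_mul_exp_I_mul, norm_mul]
  gcongr
  exact hC _ ⟨_, rfl⟩

theorem continuous_twistedCorr (A : Matrix ι ι ℝ) (φ : 𝓢(ι → ℝ, ℝ)) :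
    Continuous (twistedCorr A φ) := by
  obtain ⟨C, hC⟩ := φ.toBoundedContinuousFunction.isBounded_range.exists_norm_le
  have hφ := φ.continuous
  refine continuous_of_dominated (bound := fun y => C * ‖φ y‖) (fun u => ?_)
    (fun u => .of_forall fun y => ?_) ((φ.integrable (μ := volume)).norm.const_mul C)
    (.of_forall fun y => by fun_prop)
  · exact Continuous.aestronglyMeasurable (by fun_prop)
  · rw [norm_mul_exp_I_mul, norm_mul]
    gcongr
    exact hC _ ⟨_, rfl⟩

variable {A : Matrix ι ι ℝ}

theorem integrable_twistedCorr (hA : Aᵀ = -A) (φ : 𝓢(ι → ℝ, ℝ)) :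
    Integrable (twistedCorr A φ) := by
  have h := (φ.integrable_mul_exp_prod (t := fun p => p.1 ⬝ᵥ A *ᵥ p.2)
    (Continuous.measurable (by fun_prop))).comp_add_left_prod.integral_prod_left
  refine h.congr (.of_forall fun u => ?_)
  simp only [twistedCorr, add_dotProduct, dotProduct_mulVec_self_of_transpose_eq_neg hA, add_zero]

theorem twistedCorr_neg (A : Matrix ι ι ℝ) (hA : Aᵀ = -A) (φ : 𝓢(ι → ℝ, ℝ)) (u : ι → ℝ) :
    twistedCorr A φ (-u) =
      ∫ y, ((φ y * φ (u + y) : ℝ) : ℂ) * Complex.exp (Complex.I * ((y ⬝ᵥ A *ᵥ u : ℝ) : ℂ)) := by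
  rw [twistedCorr, ← integral_add_left_eq_self _ u]
  refine integral_congr_ae (.of_forall fun y => ?_)
  have h : -u ⬝ᵥ A *ᵥ (u + y) = y ⬝ᵥ A *ᵥ u := by
    rw [mulVec_add, dotProduct_add, neg_dotProduct, neg_dotProduct,
      dotProduct_mulVec_self_of_transpose_eq_neg hA,
      dotProduct_mulVec_of_transpose_eq_neg hA u y]
    ring
  simp only [h, neg_add_cancel_left]

theorem twistedCorr_neg_eq_conj (hA : Aᵀ = -A) (φ : 𝓢(ι → ℝ, ℝ)) (u : ι → ℝ) :
    twistedCorr A φ (-u) = starRingEnd ℂ (twistedCorr A φ u) := by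
  rw [twistedCorr_neg A hA, twistedCorr, ← integral_conj]
  refine integral_congr_ae (.of_forall fun y => ?_)
  simp only [map_mul, ← Complex.exp_conj, Complex.conj_I, Complex.conj_ofReal,
    dotProduct_mulVec_of_transpose_eq_neg hA y u, Complex.ofReal_neg, neg_mul, mul_neg,
    mul_comm (φ y)]

theorem twistedCorr_mul_neg (hA : Aᵀ = -A) (φ : 𝓢(ι → ℝ, ℝ)) (u : ι → ℝ) :
    twistedCorr A φ u * twistedCorr A φ (-u) = ((‖twistedCorr A φ u‖ ^ 2 : ℝ) : ℂ) := by
  rw [twistedCorr_neg_eq_conj hA, Complex.mul_conj, Complex.normSq_eq_norm_sq]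

theorem integral_integral_eq_fourierExp_twistedCorr (hA : Aᵀ = -A) (φ : 𝓢(ι → ℝ, ℝ))
    (k : ι → ℝ) :
    ∫ x, ∫ y, ((φ x * φ y : ℝ) : ℂ) *
        Complex.exp (Complex.I * ((k ⬝ᵥ (x - y) + x ⬝ᵥ A *ᵥ y : ℝ) : ℂ)) =
      fourierExp (twistedCorr A φ) k := by
  rw [integral_integral_eq_add_left (φ.integrable_mul_exp_prod
    (t := fun p => k ⬝ᵥ (p.1 - p.2) + p.1 ⬝ᵥ A *ᵥ p.2) (Continuous.measurable (by fun_prop)))]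
  refine integral_congr_ae (.of_forall fun u => ?_)
  simp only [twistedCorr, ← integral_const_mul]
  refine integral_congr_ae (.of_forall fun y => ?_)
  simp only [add_sub_cancel_right, add_dotProduct,
    dotProduct_mulVec_self_of_transpose_eq_neg hA, add_zero, Complex.ofReal_add, mul_add,
    Complex.exp_add]
  ring

/-- Integrating over `y` first exhibits the transform as an average of translates of the Fourier
transform of `φ`, which is integrable. -/
theorem integrable_fourierExp_twistedCorr (hA : Aᵀ = -A) (φ : 𝓢(ι → ℝ, ℝ)) :
    Integrable (fourierExp (twistedCorr A φ)) := by
  have h0 : Integrable (fun p : (ι → ℝ) × (ι → ℝ) =>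
      (φ p.1 : ℂ) * fourierExp (fun u => (φ u : ℂ)) p.2) :=
    (φ.integrable (μ := volume)).ofReal.mul_prod φ.integrable_fourierExp
  have h1 := ((MeasurePreserving.id volume).prod
    (Measure.measurePreserving_neg volume)).integrable_comp_of_integrable h0
  have h2 := ((h1.comp_prod_shear (N := fun x => A *ᵥ x) (by fun_prop)).mul_exp_I
    (t := fun p => p.2 ⬝ᵥ p.1) (Continuous.measurable (by fun_prop))).integral_prod_right
  refine h2.congr (.of_forall fun k => ?_)
  rw [← integral_integral_eq_fourierExp_twistedCorr hA]
  refine integral_congr_ae (.of_forall fun x => ?_)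
  simp only [Function.comp_apply, Prod.map, id, fourierExp, mul_assoc]
  rw [← integral_mul_const, ← integral_const_mul]
  refine integral_congr_ae (.of_forall fun y => ?_)
  have h : k ⬝ᵥ (x - y) + x ⬝ᵥ A *ᵥ y = -(k + A *ᵥ x) ⬝ᵥ y + k ⬝ᵥ x := by
    rw [dotProduct_mulVec_of_transpose_eq_neg hA x y, dotProduct_sub, neg_dotProduct,
      add_dotProduct, dotProduct_comm (A *ᵥ x)]
    ring
  simp only [h, Complex.ofReal_add, mul_add, Complex.exp_add, Complex.ofReal_mul]
  ring

theorem integral_quartic_eq_twistedCorr (hA : Aᵀ = -A) (φ : 𝓢(ι → ℝ, ℝ)) :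
    ∫ x₁, ∫ x₂, ∫ x₃, ((φ x₁ * φ x₂ * φ x₃ * φ (x₁ - x₂ + x₃) : ℝ) : ℂ) *
        Complex.exp (Complex.I * ((x₁ ⬝ᵥ A *ᵥ x₂ + x₃ ⬝ᵥ A *ᵥ (x₁ - x₂) : ℝ) : ℂ)) =
      ∫ u, twistedCorr A φ u * twistedCorr A φ (-u) := by
  obtain ⟨C, hC⟩ := exists_norm_twistedCorr_le A φ
  have hG := (φ.integrable_mul_exp_prod (t := fun p => p.1 ⬝ᵥ A *ᵥ p.2)
    (Continuous.measurable (by fun_prop))).mul_bdd (c := C)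
    (g := fun p => twistedCorr A φ (-(p.1 - p.2)))
    ((continuous_twistedCorr A φ).comp (by fun_prop)).aestronglyMeasurable
    (.of_forall fun p => hC _)
  trans ∫ x₁, ∫ x₂, ((φ x₁ * φ x₂ : ℝ) : ℂ) *
    Complex.exp (Complex.I * ((x₁ ⬝ᵥ A *ᵥ x₂ : ℝ) : ℂ)) * twistedCorr A φ (-(x₁ - x₂))
  · refine integral_congr_ae (.of_forall fun x₁ => integral_congr_ae (.of_forall fun x₂ => ?_))
    simp only [twistedCorr_neg A hA, ← integral_const_mul]
    refine integral_congr_ae (.of_forall fun x₃ => ?_)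
    simp only [Complex.ofReal_add, mul_add, Complex.exp_add, Complex.ofReal_mul]
    ring
  · rw [integral_integral_eq_add_left hG]
    refine integral_congr_ae (.of_forall fun u => ?_)
    simp only [add_sub_cancel_right, add_dotProduct,
      dotProduct_mulVec_self_of_transpose_eq_neg hA, add_zero, integral_mul_const, twistedCorr]

end TwistedCorrelation

theorem mwedge_eq_dotProduct (Θ : Matrix (Fin 4) (Fin 4) ℝ) (x y : Fin 4 → ℝ) :
    mwedge Θ x y = x ⬝ᵥ ((2 : ℝ) • Θ⁻¹) *ᵥ y := by
  rw [smul_mulVec, dotProduct_smul, smul_eq_mul]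
  simp only [mwedge, dotProduct, mulVec, Finset.mul_sum, mul_assoc]

theorem vertexPhase_eq_dotProduct {Θ : Matrix (Fin 4) (Fin 4) ℝ}
    (hA : ((2 : ℝ) • Θ⁻¹)ᵀ = -((2 : ℝ) • Θ⁻¹)) (x₁ x₂ x₃ : Fin 4 → ℝ) :
    vertexPhase Θ x₁ x₂ x₃ (x₁ - x₂ + x₃) =
      x₁ ⬝ᵥ ((2 : ℝ) • Θ⁻¹) *ᵥ x₂ + x₃ ⬝ᵥ ((2 : ℝ) • Θ⁻¹) *ᵥ (x₁ - x₂) := by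
  simp only [vertexPhase, mwedge_eq_dotProduct, mulVec_add, mulVec_sub, dotProduct_add,
    dotProduct_sub, dotProduct_mulVec_self_of_transpose_eq_neg hA]
  linarith [dotProduct_mulVec_of_transpose_eq_neg hA x₁ x₂,
    dotProduct_mulVec_of_transpose_eq_neg hA x₂ x₃]

/-- The Moyal quartic interaction is real and nonnegative: for a real-valued Schwartz
function `φ` on `ℝ⁴` and a skew-symmetric invertible `Θ`, the integral
`∫∏ᵢdxᵢ φ(xᵢ) δ(x₁−x₂+x₃−x₄) e^{iφ̃}` (with the delta function resolved, i.e. with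
`x₄ = x₁ − x₂ + x₃`, equivalently via the auxiliary integral
`δ(u) = (2π)^{-4}∫ e^{ik·u} dk`) equals
`(2π)^{-4} ∫ dk (∫∫ dx dy φ(x)φ(y) e^{ik·(x−y)+ i x∧y})²`, and it is a nonnegative
real number. -/
theorem moyal_interaction_positive (Θ : Matrix (Fin 4) (Fin 4) ℝ)
    (hskew : Θᵀ = -Θ) (hdet : IsUnit Θ.det)
    (φ : SchwartzMap (Fin 4 → ℝ) ℝ) :
    (∫ x₁ : Fin 4 → ℝ, ∫ x₂ : Fin 4 → ℝ, ∫ x₃ : Fin 4 → ℝ,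
        ((φ x₁ * φ x₂ * φ x₃ * φ (x₁ - x₂ + x₃) : ℝ) : ℂ) *
          Complex.exp (Complex.I *
            ((vertexPhase Θ x₁ x₂ x₃ (x₁ - x₂ + x₃) : ℝ) : ℂ)))
      = (((2 * Real.pi) ^ 4 : ℝ) : ℂ)⁻¹ *
          (∫ k : Fin 4 → ℝ,
            (∫ x : Fin 4 → ℝ, ∫ y : Fin 4 → ℝ,
                ((φ x * φ y : ℝ) : ℂ) *
                  Complex.exp (Complex.I *
                    (((∑ a, k a * (x a - y a)) + mwedge Θ x y : ℝ) : ℂ))) ^ 2) ∧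
    ∃ r : ℝ, 0 ≤ r ∧
      (∫ x₁ : Fin 4 → ℝ, ∫ x₂ : Fin 4 → ℝ, ∫ x₃ : Fin 4 → ℝ,
          ((φ x₁ * φ x₂ * φ x₃ * φ (x₁ - x₂ + x₃) : ℝ) : ℂ) *
            Complex.exp (Complex.I *
              ((vertexPhase Θ x₁ x₂ x₃ (x₁ - x₂ + x₃) : ℝ) : ℂ))) = (r : ℂ) := by
  have hA : ((2 : ℝ) • Θ⁻¹)ᵀ = -((2 : ℝ) • Θ⁻¹) := by
    have hinv : (-Θ)⁻¹ = -Θ⁻¹ :=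
      inv_eq_left_inv (by rw [neg_mul_neg, nonsing_inv_mul _ hdet])
    rw [transpose_smul, transpose_nonsing_inv, hskew, hinv, smul_neg]
  simp only [vertexPhase_eq_dotProduct hA]
  rw [integral_quartic_eq_twistedCorr hA]
  refine ⟨?_, ∫ u, ‖twistedCorr ((2 : ℝ) • Θ⁻¹) φ u‖ ^ 2,
    integral_nonneg fun u => by positivity, ?_⟩
  · have hF (k : Fin 4 → ℝ) := integral_integral_eq_fourierExp_twistedCorr hA φ k
    simp only [dotProduct, Pi.sub_apply] at hF
    simp only [mwedge_eq_dotProduct, dotProduct, hF]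
    rw [integral_fourierExp_sq (continuous_twistedCorr _ φ) (integrable_twistedCorr hA φ)
      (integrable_fourierExp_twistedCorr hA φ), Fintype.card_fin, inv_mul_cancel_left₀]
    exact Complex.ofReal_ne_zero.2 (pow_ne_zero _ Real.two_pi_pos.ne')
  · simp only [twistedCorr_mul_neg hA]
    exact integral_ofReal
end
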